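/- arXiv:2306.02419 — 2 statements merged into one kernel-verified Lean document; each statement's English description precedes it below -/
import Mathlib

section
/- (Proposition 2) There exist an FHMDP, a policy π, and a π-minimal history representation Φ^{π*} with variable subsets Θ̄^{π*}_t such that Θ̄^{π*}_t contains a variable not belonging to the union, over all minimal Markov history representations Φ*, of their variable subsets Θ̄*_t; i.e., Θ̄^{π*}_t \ {Θ̄*_t}_{∪Φ*} ≠ ∅, so a π-minimal representation can contain a superfluous variable. -/
open scoped Classical

noncomputable section

/-- The static part of a factored (history) MDP: a finite action set and, for each
timestep, a finite set of observation variables, each with a finite set of values. -/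
structure PreFHMDP where
  /-- The set of actions. -/
  A : Type
  [fintA : Fintype A]
  /-- The observation variables at each timestep. -/
  ObsVar : ℕ → Type
  [fintObsVar : ∀ t, Fintype (ObsVar t)]
  [decObsVar : ∀ t, DecidableEq (ObsVar t)]
  /-- The possible values of each observation variable. -/
  Val : ∀ t, ObsVar t → Type
  [fintVal : ∀ t v, Fintype (Val t v)]

attribute [instance] PreFHMDP.fintA PreFHMDP.fintObsVar PreFHMDP.decObsVar PreFHMDP.fintVal

namespace PreFHMDP

/-- An observation at timestep `t`: a vector of values of the observation variables. -/
def Obs (M : PreFHMDP) (t : ℕ) : Type := ∀ v : M.ObsVar t, M.Val t v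

instance (M : PreFHMDP) (t : ℕ) : Fintype (M.Obs t) :=
  inferInstanceAs (Fintype (∀ v : M.ObsVar t, M.Val t v))

/-- Histories of length `t` (with observations `o_0, ..., o_t` and actions
`a_0, ..., a_{t-1}`): alternating observation-action sequences that begin and
end with an observation. -/
def Hist (M : PreFHMDP) : ℕ → Type
  | 0 => M.Obs 0
  | t + 1 => M.Hist t × M.A × M.Obs (t + 1)

instance fintypeHist (M : PreFHMDP) : ∀ t, Fintype (M.Hist t)
  | 0 => inferInstanceAs (Fintype (M.Obs 0))
  | t + 1 =>
    letI := fintypeHist M t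
    inferInstanceAs (Fintype (M.Hist t × M.A × M.Obs (t + 1)))

/-- The history of length `t` preceding a history of length `t + 1`. -/
def Hist.prev {M : PreFHMDP} {t : ℕ} : M.Hist (t + 1) → M.Hist t :=
  fun h : M.Hist t × M.A × M.Obs (t + 1) => h.1

/-- The last action of a history of length `t + 1`. -/
def Hist.act {M : PreFHMDP} {t : ℕ} : M.Hist (t + 1) → M.A :=
  fun h : M.Hist t × M.A × M.Obs (t + 1) => h.2.1

/-- The last observation of a history of length `t + 1`. -/
def Hist.obs {M : PreFHMDP} {t : ℕ} : M.Hist (t + 1) → M.Obs (t + 1) :=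
  fun h : M.Hist t × M.A × M.Obs (t + 1) => h.2.2

/-- Extending a history with an action and a next observation:
`h.snoc a o = ⟨h, a, o⟩`. -/
def Hist.snoc {M : PreFHMDP} {t : ℕ} (h : M.Hist t) (a : M.A) (o : M.Obs (t + 1)) :
    M.Hist (t + 1) :=
  show M.Hist t × M.A × M.Obs (t + 1) from (h, a, o)

/-- The set `Θ_t` of variables of a history of length `t`: the observation variables
of timesteps `0, ..., t` together with one (action-valued) variable for each of the
actions `a_0, ..., a_{t-1}`. -/
def HVar (M : PreFHMDP) : ℕ → Type
  | 0 => M.ObsVar 0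
  | t + 1 => M.HVar t ⊕ (Unit ⊕ M.ObsVar (t + 1))

/-- The type of values of each history variable. -/
def HVal (M : PreFHMDP) : ∀ t, M.HVar t → Type
  | 0, v => M.Val 0 v
  | _ + 1, Sum.inl θ => M.HVal _ θ
  | _ + 1, Sum.inr (Sum.inl _) => M.A
  | t + 1, Sum.inr (Sum.inr v) => M.Val (t + 1) v

/-- The value a history assigns to each of its variables, so that a history of
length `t` is a vector of values of the variable set `Θ_t`. -/
def hval (M : PreFHMDP) : ∀ t, ∀ _h : M.Hist t, ∀ θ : M.HVar t, M.HVal t θ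
  | 0, h, v => h v
  | t + 1, h, Sum.inl θ => M.hval t h.prev θ
  | _ + 1, h, Sum.inr (Sum.inl _) => h.act
  | _ + 1, h, Sum.inr (Sum.inr v) => h.obs v

end PreFHMDP

/-- A factored history MDP (FHMDP): actions, factored observations, a distribution over
initial observations, a history transition function (a distribution over successor
histories `⟨h_t, a_t, o_{t+1}⟩`, i.e. over next observations), and a history reward
function. -/
structure FHMDP extends PreFHMDP where
  /-- The distribution over initial observations. -/
  init : toPreFHMDP.Obs 0 → ℝ
  init_nonneg : ∀ o, 0 ≤ init o
  init_sum_one : ∑ o, init o = 1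
  /-- The history transition function `T_h`: the probability that history `h_t` with
  action `a_t` is followed by the successor history `⟨h_t, a_t, o_{t+1}⟩`. -/
  Th : ∀ t, toPreFHMDP.Hist t → toPreFHMDP.A → toPreFHMDP.Obs (t + 1) → ℝ
  Th_nonneg : ∀ t h a o, 0 ≤ Th t h a o
  Th_sum_one : ∀ t h a, ∑ o, Th t h a o = 1
  /-- The history reward function `R_h`. -/
  Rh : ∀ t, toPreFHMDP.Hist t → toPreFHMDP.A → ℝ

namespace FHMDP

/-- A (stochastic) policy: a probability distribution over actions for each history. -/
structure Policy (M : FHMDP) where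
  p : ∀ t, M.Hist t → M.A → ℝ
  nonneg : ∀ t h a, 0 ≤ p t h a
  sum_one : ∀ t h, ∑ a, p t h a = 1

/-- `supp (π(·∣h))`: the set of actions given positive probability at `h`. -/
def Policy.supp {M : FHMDP} (π : M.Policy) (t : ℕ) (h : M.Hist t) : Set M.A :=
  {a | 0 < π.p t h a}

/-- `H^π`: the set of histories reachable with positive probability under `π`. -/
def Reach (M : FHMDP) (π : M.Policy) : ∀ t, Set (M.Hist t)
  | 0 => {o | 0 < M.init o}
  | t + 1 => {h | h.prev ∈ M.Reach π t ∧ 0 < π.p t h.prev h.act ∧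
      0 < M.Th t h.prev h.act h.obs}

/-- A history representation `Φ`: for each history length `t`, the projection onto a
subset `Θ̄_t ⊆ Θ_t` of the history variables (given by the set of kept variables). -/
structure HistRep (M : FHMDP) where
  keep : ∀ t, Set (M.HVar t)

/-- Two histories of the same length have the same image under the representation `Φ`
(`Φ(h) = Φ(h')`, i.e. `h' ∈ {h}^Φ`) iff they agree on all kept variables. -/
def HistRep.eqv {M : FHMDP} (Φ : M.HistRep) (t : ℕ) (h h' : M.Hist t) : Prop :=
  ∀ θ ∈ Φ.keep t, M.hval t h θ = M.hval t h' θ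

/-- The probability `T_h(h2 ∣ h, a)` of moving from the history `h` (of length `t`)
with action `a` to the history `h2` (of length `t + 1`). -/
def TProb (M : FHMDP) {t : ℕ} (h : M.Hist t) (a : M.A) (h2 : M.Hist (t + 1)) : ℝ :=
  if h2.prev = h ∧ h2.act = a then M.Th t h a h2.obs else 0

/-- The probability of transitioning from `h` with action `a` into the equivalence
class of `h2` under `Φ`, restricted to the set of histories `S`:
`∑_{h2' ∈ {h2}^Φ ∩ S} T_h(h2' ∣ h, a)`. -/
def classSum (M : FHMDP) (Φ : M.HistRep) (S : ∀ t, Set (M.Hist t)) {t : ℕ}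
    (h : M.Hist t) (a : M.A) (h2 : M.Hist (t + 1)) : ℝ :=
  ∑ h2' : M.Hist (t + 1),
    if h2' ∈ S (t + 1) ∧ Φ.eqv (t + 1) h2 h2' then M.TProb h a h2' else 0

/-- A Markov history representation: for all histories `h_t, h_{t+1}` and actions `a_t`,
the reward `R_h(·, a_t)` is constant on `{h_t}^Φ`, and the probability of the class
`{h_{t+1}}^Φ` given `h_t, a_t` depends on `h_t` only through `Φ(h_t)`. -/
def IsMarkov (M : FHMDP) (Φ : M.HistRep) : Prop :=
  (∀ t, ∀ h h' : M.Hist t, Φ.eqv t h h' → ∀ a : M.A, M.Rh t h a = M.Rh t h' a) ∧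
  (∀ t, ∀ h h' : M.Hist t, Φ.eqv t h h' → ∀ a : M.A, ∀ h2 : M.Hist (t + 1),
    M.classSum Φ (fun _ => Set.univ) h a h2 = M.classSum Φ (fun _ => Set.univ) h' a h2)

/-- A `π`-Markov history representation: the Markov conditions restricted to histories
in `H^π` and actions in `supp (π(·∣h_t))`, with classes `{·}^Φ_π` intersected with `H^π`. -/
def IsPiMarkov (M : FHMDP) (π : M.Policy) (Φ : M.HistRep) : Prop :=
  (∀ t, ∀ h ∈ M.Reach π t, ∀ h' ∈ M.Reach π t, Φ.eqv t h h' →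
    ∀ a ∈ π.supp t h, M.Rh t h a = M.Rh t h' a) ∧
  (∀ t, ∀ h ∈ M.Reach π t, ∀ h' ∈ M.Reach π t, Φ.eqv t h h' →
    ∀ a ∈ π.supp t h, ∀ h2 ∈ M.Reach π (t + 1),
      M.classSum Φ (M.Reach π) h a h2 = M.classSum Φ (M.Reach π) h' a h2)

/-- A minimal Markov history representation: `Φs` is Markov, and every history
representation whose variable subset is a proper subset of `Θ̄*_t` for at least one
history (length) is not Markov. -/
def IsMinimalMarkov (M : FHMDP) (Φs : M.HistRep) : Prop :=
  M.IsMarkov Φs ∧ ∀ Φ : M.HistRep, (∃ t, Φ.keep t ⊂ Φs.keep t) → ¬M.IsMarkov Φ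

/-- A `π`-minimal history representation: `Φs` is `π`-Markov, and every history
representation whose variable subset is a proper subset of `Θ̄^{π*}_t` for at least one
history (length) in `H^π` is not `π`-Markov. -/
def IsPiMinimal (M : FHMDP) (π : M.Policy) (Φs : M.HistRep) : Prop :=
  M.IsPiMarkov π Φs ∧ ∀ Φ : M.HistRep, (∃ t, Φ.keep t ⊂ Φs.keep t) → ¬M.IsPiMarkov π Φ

/-- `Φ` is confounded by the policy `π`: for some `h_t, h_{t+1}, a_t` the conditional
reward/class-transition probability under `π` differs from its interventional
(`do(Φ(h_t))`) counterpart. Equivalently, `Φ` is NOT confounded by `π` iff for all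
`h_t, h_{t+1}, a_t`: `R_h(·, a_t)` is constant on the full class `{h_t}^Φ` and the sum of
`T_h(h'_{t+1} ∣ h_t, a_t)` over `h'_{t+1} ∈ {h_{t+1}}^Φ` is constant on the full class
`{h_t}^Φ` (irrespective of the policy). -/
def ConfoundedBy (M : FHMDP) (Φ : M.HistRep) (_π : M.Policy) : Prop :=
  ¬((∀ t, ∀ h h' : M.Hist t, Φ.eqv t h h' → ∀ a : M.A, M.Rh t h a = M.Rh t h' a) ∧
    (∀ t, ∀ h h' : M.Hist t, Φ.eqv t h h' → ∀ a : M.A, ∀ h2 : M.Hist (t + 1),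
      M.classSum Φ (fun _ => Set.univ) h a h2 = M.classSum Φ (fun _ => Set.univ) h' a h2))

/-- `value M π n t h`: the expected return `E_π[∑_{k=t}^{t+n} R_h(h_k, a_k) ∣ h_t = h]`,
where actions are sampled as `a_k ~ π(·∣h_k)` and histories evolve as
`h_{k+1} ~ T_h(·∣h_k, a_k)`. -/
def value (M : FHMDP) (π : M.Policy) : ℕ → ∀ t, M.Hist t → ℝ
  | 0, t, h => ∑ a : M.A, π.p t h a * M.Rh t h a
  | n + 1, t, h => ∑ a : M.A, π.p t h a *
      (M.Rh t h a + ∑ o : M.Obs (t + 1), M.Th t h a o * M.value π n (t + 1) (h.snoc a o))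

end FHMDP

namespace Superfluous

/-- Two binary variables are observed at timestep `0` and none afterwards; there is a
single action. -/
def pre : PreFHMDP where
  A := Unit
  ObsVar t := match t with
    | 0 => Bool
    | _ + 1 => Empty
  fintObsVar t := match t with
    | 0 => inferInstanceAs (Fintype Bool)
    | _ + 1 => inferInstanceAs (Fintype Empty)
  decObsVar t := match t with
    | 0 => inferInstanceAs (DecidableEq Bool)
    | _ + 1 => inferInstanceAs (DecidableEq Empty)
  Val _ _ := Bool

/-- The initial observation giving both variables the value `b`. -/
def diag (b : Bool) : pre.Obs 0 := fun _ => b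

/-- The initial observation whose variable `false` has value `b` and whose variable `true`
has value `true`. -/
def rightTrue (b : Bool) : pre.Obs 0 := fun v : Bool => v || b

instance (t : ℕ) : Unique (pre.Obs (t + 1)) where
  default := fun v : Empty => v.elim
  uniq _ := funext fun v : Empty => v.elim

/-- The two initial variables are equal with probability one, and the only nonzero
rewards are at timestep `0`, where they are determined by the variable `false`. -/
def mdp : FHMDP where
  toPreFHMDP := pre
  init o := (if o = diag true then 1 / 2 else 0) + (if o = diag false then 1 / 2 else 0)
  init_nonneg o := by split_ifs <;> norm_num
  init_sum_one := by
    rw [Finset.sum_add_distrib, Finset.sum_ite_eq', Finset.sum_ite_eq']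
    norm_num
  Th _ _ _ _ := 1
  Th_nonneg _ _ _ _ := zero_le_one
  Th_sum_one _ _ _ := by simp
  Rh t h _ := match t, h with
    | 0, h => bif (h : Bool → Bool) false then 1 else 0
    | _ + 1, _ => 0

/-- The only policy of `mdp`. -/
def policy : mdp.Policy where
  p _ _ _ := 1
  nonneg _ _ _ := zero_le_one
  sum_one _ _ := by
    change ∑ _a : Unit, (1 : ℝ) = 1
    simp

/-- The representation keeping exactly the initial variable `b` at timestep `0` and
nothing afterwards. -/
def keepOnly (b : Bool) : mdp.HistRep where
  keep t := match t with
    | 0 => ({b} : Set Bool)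
    | _ + 1 => ∅

theorem classSum_keepOnly (b : Bool) (S : ∀ t, Set (mdp.Hist t)) {t : ℕ} (h : mdp.Hist t)
    (a : mdp.A) (h2 : mdp.Hist (t + 1))
    (hS : PreFHMDP.Hist.snoc h a (default : pre.Obs (t + 1)) ∈ S (t + 1)) :
    mdp.classSum (keepOnly b) S h a h2 = 1 := by
  unfold FHMDP.classSum
  rw [Finset.sum_eq_single (PreFHMDP.Hist.snoc h a (default : pre.Obs (t + 1)))]
  · rw [if_pos ⟨hS, fun θ hθ => absurd hθ (Set.notMem_empty θ)⟩]
    exact if_pos ⟨rfl, rfl⟩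
  · intro h' _ hne
    have hT : mdp.TProb h a h' = 0 := by
      refine if_neg ?_
      rintro ⟨rfl, rfl⟩
      exact hne (Prod.ext rfl (Prod.ext rfl (Unique.eq_default (α := pre.Obs (t + 1)) _)))
    rw [hT, ite_self]
  · exact fun hn => absurd (Finset.mem_univ _) hn

theorem isMarkov_keepOnly_false : mdp.IsMarkov (keepOnly false) := by
  refine ⟨fun t h h' e a => ?_, fun t h h' _ a h2 => ?_⟩
  · cases t with
    | zero =>
      have e' : (h : Bool → Bool) false = (h' : Bool → Bool) false :=
        e false (Set.mem_singleton false)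
      change (bif (h : Bool → Bool) false then (1 : ℝ) else 0) =
        bif (h' : Bool → Bool) false then 1 else 0
      rw [e']
    | succ t => rfl
  · rw [classSum_keepOnly _ _ _ _ _ (Set.mem_univ _),
      classSum_keepOnly _ _ _ _ _ (Set.mem_univ _)]

theorem false_eq_true_of_mem_reach {h : mdp.Hist 0} (hh : h ∈ mdp.Reach policy 0) :
    (h : Bool → Bool) false = (h : Bool → Bool) true := by
  have hpos : (0 : ℝ) < (if h = diag true then 1 / 2 else 0) +
    (if h = diag false then 1 / 2 else 0) := hh
  by_cases h1 : h = diag true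
  · subst h1; rfl
  by_cases h2 : h = diag false
  · subst h2; rfl
  rw [if_neg h1, if_neg h2, add_zero] at hpos
  exact absurd hpos (lt_irrefl _)

theorem diag_mem_reach (b : Bool) : diag b ∈ mdp.Reach policy 0 := by
  change (0 : ℝ) < (if diag b = diag true then 1 / 2 else 0) +
    (if diag b = diag false then 1 / 2 else 0)
  cases b
  · rw [if_pos (rfl : diag false = diag false)]
    split_ifs <;> norm_num
  · rw [if_pos (rfl : diag true = diag true)]
    split_ifs <;> norm_num

theorem isPiMarkov_keepOnly_true : mdp.IsPiMarkov policy (keepOnly true) := by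
  refine ⟨fun t h hh h' hh' e a _ => ?_, fun t h hh h' hh' _ a _ h2 _ => ?_⟩
  · cases t with
    | zero =>
      have e' : (h : Bool → Bool) true = (h' : Bool → Bool) true :=
        e true (Set.mem_singleton true)
      change (bif (h : Bool → Bool) false then (1 : ℝ) else 0) =
        bif (h' : Bool → Bool) false then 1 else 0
      rw [false_eq_true_of_mem_reach hh, false_eq_true_of_mem_reach hh', e']
    | succ t => rfl
  · have hsnoc : ∀ k ∈ mdp.Reach policy t,
        PreFHMDP.Hist.snoc k a (default : pre.Obs (t + 1)) ∈ mdp.Reach policy (t + 1) :=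
      fun k hk => ⟨hk, zero_lt_one (α := ℝ), zero_lt_one (α := ℝ)⟩
    rw [classSum_keepOnly _ _ _ _ _ (hsnoc h hh), classSum_keepOnly _ _ _ _ _ (hsnoc h' hh')]

theorem reward_ne {h h' : mdp.Hist 0} (hf : (h : Bool → Bool) false = false)
    (ht : (h' : Bool → Bool) false = true) : mdp.Rh 0 h () ≠ mdp.Rh 0 h' () := by
  have key : ∀ x y : Bool, x = false → y = true →
      (bif x then (1 : ℝ) else 0) ≠ bif y then 1 else 0 := by
    rintro _ _ rfl rfl
    exact zero_ne_one
  exact key _ _ hf ht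

theorem isPiMinimal_keepOnly_true : mdp.IsPiMinimal policy (keepOnly true) := by
  refine ⟨isPiMarkov_keepOnly_true, ?_⟩
  rintro Φ ⟨t, ht⟩ hΦ
  cases t with
  | zero =>
    have hempty : Φ.keep 0 = ∅ := Set.ssubset_singleton_iff.mp ht
    refine reward_ne rfl rfl (hΦ.1 0 (diag false) (diag_mem_reach _) (diag true)
      (diag_mem_reach _) (fun θ hθ => ?_) () (zero_lt_one (α := ℝ)))
    rw [hempty] at hθ
    exact absurd hθ (Set.notMem_empty θ)
  | succ t => exact Set.notMem_empty _ (Set.exists_of_ssubset ht).choose_spec.1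

theorem false_mem_keep_of_isMarkov {Φ : mdp.HistRep} (hΦ : mdp.IsMarkov Φ) :
    (false : Bool) ∈ (Φ.keep 0 : Set Bool) := by
  by_contra hn
  refine reward_ne rfl rfl (hΦ.1 0 (rightTrue false) (rightTrue true) (fun θ hθ => ?_) ())
  change Bool at θ
  cases θ
  · exact absurd hθ hn
  · rfl

end Superfluous

/-- **Proposition 2.** There exist an FHMDP, a policy `π`, and a
`π`-minimal history representation `Φ^{π*}` whose variable subset `Θ̄^{π*}_t` contains a
variable not belonging to the union, over all minimal Markov history representations
`Φ*`, of their variable subsets `Θ̄*_t`; i.e. a `π`-minimal representation can contain a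
superfluous variable. -/
theorem exists_piMinimal_with_superfluous_variable :
    ∃ (M : FHMDP) (π : M.Policy) (Φπs : M.HistRep),
      M.IsPiMinimal π Φπs ∧
      ∃ t, ∃ θ ∈ Φπs.keep t,
        ∀ Φs : M.HistRep, M.IsMinimalMarkov Φs → θ ∉ Φs.keep t := by
  refine ⟨Superfluous.mdp, Superfluous.policy, Superfluous.keepOnly true,
    Superfluous.isPiMinimal_keepOnly_true, 0, true, Set.mem_singleton true, ?_⟩
  intro Φs hΦs hmem
  refine hΦs.2 (Superfluous.keepOnly false) ⟨0, ?_⟩ Superfluous.isMarkov_keepOnly_false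
  refine ⟨Set.singleton_subset_iff.mpr
    (Superfluous.false_mem_keep_of_isMarkov hΦs.1), fun hsub => ?_⟩
  have : (true : Bool) = false := hsub hmem
  cases this
end
end

section
/- (Value equivalence of Markov history representations) Let Φ be a Markov history representation and let π be a policy that factors through Φ, i.e., π(·|h_t) = π(·|h'_t) whenever Φ(h_t) = Φ(h'_t). Then for any finite horizon T, the expected return under π starting from a history, i.e., the expected sum of rewards E_π[Σ_{k=t}^{T} R_h(h_k, a_k) | h_t], depends on the starting history h_t only through Φ(h_t): if Φ(h_t) = Φ(h'_t) then the expected returns from h_t and from h'_t are equal. -/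
open scoped Classical

noncomputable section

namespace FHMDP

lemma HistRep.eqv_equivalence {M : FHMDP} (Φ : M.HistRep) (t : ℕ) : Equivalence (Φ.eqv t) where
  refl _ _ _ := rfl
  symm h θ hθ := (h θ hθ).symm
  trans h h' θ hθ := (h θ hθ).trans (h' θ hθ)

/-- The setoid on histories of length `t` identifying histories with the same image
under `Φ`. -/
def HistRep.setoid {M : FHMDP} (Φ : M.HistRep) (t : ℕ) : Setoid (M.Hist t) :=
  ⟨Φ.eqv t, Φ.eqv_equivalence t⟩

lemma sum_TProb_mul (M : FHMDP) {t : ℕ} (h : M.Hist t) (a : M.A) (f : M.Hist (t + 1) → ℝ) :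
    ∑ h2, M.TProb h a h2 * f h2 = ∑ o, M.Th t h a o * f (h.snoc a o) := by
  symm
  refine Finset.sum_of_injOn (fun o => h.snoc a o) ?_ (fun _ _ => Finset.mem_univ _) ?_ ?_
  · intro o _ o' _ he
    exact congrArg PreFHMDP.Hist.obs he
  · intro h2 _ hn
    have : ¬(h2.prev = h ∧ h2.act = a) := by
      rintro ⟨rfl, rfl⟩
      exact hn ⟨h2.obs, Finset.mem_coe.2 (Finset.mem_univ _), rfl⟩
    simp [TProb, this]
  · intro o _
    have : (h.snoc a o).prev = h ∧ (h.snoc a o).act = a := ⟨rfl, rfl⟩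
    rw [TProb, if_pos this]
    rfl

/-- The expectation of a function of the next history that is constant on the classes of `Φ`
is determined by the class transition probabilities. -/
lemma sum_TProb_mul_eq_sum_classSum (M : FHMDP) (Φ : M.HistRep) {t : ℕ} (h : M.Hist t) (a : M.A)
    (f : M.Hist (t + 1) → ℝ) (hf : ∀ x y, Φ.eqv (t + 1) x y → f x = f y) :
    ∑ h2, M.TProb h a h2 * f h2 =
      ∑ q : Quotient (Φ.setoid (t + 1)),
        M.classSum Φ (fun _ => Set.univ) h a q.out * f q.out := by
  rw [← Finset.sum_fiberwise Finset.univ (fun x => Quotient.mk (Φ.setoid (t + 1)) x)]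
  refine Finset.sum_congr rfl fun q _ => ?_
  rw [classSum, Finset.sum_mul, Finset.sum_filter]
  refine Finset.sum_congr rfl fun x _ => ?_
  have hiff : Quotient.mk (Φ.setoid (t + 1)) x = q ↔ Φ.eqv (t + 1) q.out x := by
    rw [eq_comm]
    exact Quotient.eq_mk_iff_out
  by_cases hx : Φ.eqv (t + 1) q.out x
  · simp [hiff, hx, hf _ _ hx]
  · simp [hiff, hx]

lemma IsMarkov.value_eq {M : FHMDP} {Φ : M.HistRep} (hmarkov : M.IsMarkov Φ) {π : M.Policy}
    (hfac : ∀ t (h h' : M.Hist t), Φ.eqv t h h' → π.p t h = π.p t h') (n : ℕ) :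
    ∀ t (h h' : M.Hist t), Φ.eqv t h h' → M.value π n t h = M.value π n t h' := by
  induction n with
  | zero =>
    intro t h h' he
    simp only [value, hfac t h h' he, hmarkov.1 t h h' he]
  | succ n ih =>
    intro t h h' he
    simp only [value, hfac t h h' he, hmarkov.1 t h h' he, ← sum_TProb_mul,
      sum_TProb_mul_eq_sum_classSum M Φ _ _ _ (ih (t + 1)), hmarkov.2 t h h' he]

end FHMDP

/-- **value equivalence of Markov history representations.** Let `Φ` be a
Markov history representation and `π` a policy that factors through `Φ` (i.e.
`π(·∣h_t) = π(·∣h'_t)` whenever `Φ(h_t) = Φ(h'_t)`). Then for any finite horizon `T`,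
the expected return `E_π[∑_{k=t}^{T} R_h(h_k, a_k) ∣ h_t]` depends on the starting
history `h_t` only through `Φ(h_t)`: if `Φ(h_t) = Φ(h'_t)` then the expected returns
from `h_t` and from `h'_t` are equal. -/
theorem value_eq_of_eqv (M : FHMDP) (Φ : M.HistRep) (hmarkov : M.IsMarkov Φ)
    (π : M.Policy)
    (hfac : ∀ t (h h' : M.Hist t), Φ.eqv t h h' → π.p t h = π.p t h') :
    ∀ T t, t ≤ T → ∀ h h' : M.Hist t, Φ.eqv t h h' →
      M.value π (T - t) t h = M.value π (T - t) t h' := by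
  intro T t _ h h' he
  exact hmarkov.value_eq hfac (T - t) t h h' he
end
end
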